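/- arXiv:2107.08225 — 3 statements merged into one kernel-verified Lean document; each statement's English description precedes it below -/
import Mathlib

section
/- Let α ≥ 0 and let x : [0,∞) → ℝ^n be absolutely continuous with ẋ(t) ∈ V_α(x(t)) for almost every t ≥ 0. If x(0) ∈ C, then x(t) ∈ C for all t ≥ 0; that is, the velocity constraint ẋ(t) ∈ V_α(x(t)) together with a feasible initial condition enforces the position constraint for all times. -/
open scoped RealInnerProductSpace
open MeasureTheory

/-- A function whose increments are dominated by a multiple of those of an absolutely continuous
function is absolutely continuous. -/
theorem AbsolutelyContinuousOnInterval.of_dist_le_mul {X Y : Type*} [PseudoMetricSpace X]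
    [PseudoMetricSpace Y] {f : ℝ → X} {G : ℝ → Y} {a b K : ℝ}
    (hG : AbsolutelyContinuousOnInterval G a b)
    (hfG : ∀ s ∈ Set.uIcc a b, ∀ t ∈ Set.uIcc a b, dist (f s) (f t) ≤ K * dist (G s) (G t)) :
    AbsolutelyContinuousOnInterval f a b := by
  unfold AbsolutelyContinuousOnInterval at hG ⊢
  refine squeeze_zero' (.of_forall fun _ ↦ Finset.sum_nonneg fun _ _ ↦ dist_nonneg) ?_
    (by simpa using hG.const_mul K)
  rw [Filter.eventually_inf_principal]
  refine .of_forall fun I hI ↦ ?_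
  rw [Finset.mul_sum]
  exact Finset.sum_le_sum fun i hi ↦ hfG _ (hI.1 i hi).1 _ (hI.1 i hi).2

/-- The composition of a `C^1` function on a finite-dimensional space with an indefinite integral
is absolutely continuous. -/
theorem ContDiff.absolutelyContinuousOnInterval_comp_integral
    {E F : Type*} [NormedAddCommGroup E] [NormedSpace ℝ E] [FiniteDimensional ℝ E]
    [NormedAddCommGroup F] [NormedSpace ℝ F]
    {f : E → F} (hf : ContDiff ℝ 1 f) {x v : ℝ → E} {a b : ℝ}
    (hv : IntervalIntegrable v volume a b)
    (hx : ∀ t ∈ Set.uIcc a b, x t = x a + ∫ τ in a..t, v τ) :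
    AbsolutelyContinuousOnInterval (fun t ↦ f (x t)) a b := by
  have hsub : ∀ s ∈ Set.uIcc a b, IntervalIntegrable v volume a s := fun s hs ↦
    hv.mono_set (Set.uIcc_subset_uIcc_left hs)
  have hcont : ContinuousOn x (Set.uIcc a b) :=
    (continuousOn_const.add (intervalIntegral.continuousOn_primitive_interval'
      hv Set.left_mem_uIcc)).congr hx
  obtain ⟨R, hR⟩ := (isCompact_uIcc.image_of_continuousOn hcont).isBounded.subset_closedBall 0
  obtain ⟨K, hK⟩ := hf.contDiffOn.exists_lipschitzOnWith one_ne_zero (convex_closedBall (0 : E) R)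
    (isCompact_closedBall 0 R)
  refine (hv.norm.absolutelyContinuousOnInterval_intervalIntegral
    Set.left_mem_uIcc).of_dist_le_mul (K := K) fun s hs t ht ↦ ?_
  refine (hK.dist_le_mul _ (hR ⟨s, hs, rfl⟩) _ (hR ⟨t, ht, rfl⟩)).trans ?_
  gcongr
  rw [hx s hs, hx t ht, dist_add_left, dist_eq_norm, Real.dist_eq,
    intervalIntegral.integral_interval_sub_left (hsub s hs) (hsub t ht),
    intervalIntegral.integral_interval_sub_left (hsub s hs).norm (hsub t ht).norm]
  exact intervalIntegral.norm_integral_le_abs_integral_norm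

/-- An absolutely continuous function that starts nonnegative and is almost everywhere
nondecreasing where it is nonpositive stays nonnegative. -/
theorem AbsolutelyContinuousOnInterval.nonneg_of_deriv_nonneg_of_nonpos {φ : ℝ → ℝ} {a b : ℝ}
    (hab : a ≤ b) (hφ : AbsolutelyContinuousOnInterval φ a b) (ha : 0 ≤ φ a)
    (hd : ∀ᵐ t ∂(volume : Measure ℝ), t ∈ Set.Ioo a b → φ t ≤ 0 → 0 ≤ deriv φ t) :
    0 ≤ φ b := by
  by_contra! hb
  have hcont : ContinuousOn φ (Set.Icc a b) := Set.uIcc_of_le hab ▸ hφ.continuousOn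
  have hcompact : IsCompact (Set.Icc a b ∩ φ ⁻¹' Set.Ici 0) :=
    isCompact_Icc.of_isClosed_subset (hcont.preimage_isClosed_of_isClosed isClosed_Icc isClosed_Ici)
      Set.inter_subset_left
  obtain ⟨s, ⟨hs, hs0⟩, hmax⟩ := hcompact.exists_isGreatest ⟨a, ⟨le_rfl, hab⟩, ha⟩
  have hneg : ∀ t ∈ Set.Ioc s b, φ t < 0 := fun t ht ↦ by
    by_contra! h0
    exact ht.1.not_ge (hmax ⟨⟨hs.1.trans ht.1.le, ht.2⟩, h0⟩)
  have hint := (hφ.mono (c := s) (d := b) (Set.uIcc_subset_uIcc_right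
    (Set.uIcc_of_le hab ▸ hs))).integral_deriv_eq_sub
  have hnonneg : 0 ≤ ∫ t in s..b, deriv φ t := by
    refine intervalIntegral.integral_nonneg_of_ae_restrict hs.2 ?_
    rw [← restrict_Ioo_eq_restrict_Icc]
    refine (ae_restrict_iff' measurableSet_Ioo).2 ?_
    filter_upwards [hd] with t ht hts
    exact ht ⟨hs.1.trans_lt hts.1, hts.2⟩ (hneg t ⟨hts.1, hts.2.le⟩).le
  have : 0 ≤ φ s := hs0
  linarith

theorem contDiff_one_of_hasGradientAt {E : Type*} [NormedAddCommGroup E] [InnerProductSpace ℝ E]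
    [CompleteSpace E] {f : E → ℝ} {f' : E → E} (hf : ∀ y, HasGradientAt f (f' y) y)
    (hf' : Continuous f') : ContDiff ℝ 1 f :=
  contDiff_one_iff_hasFDerivAt.2
    ⟨fun y ↦ InnerProductSpace.toDual ℝ E (f' y),
      (InnerProductSpace.toDual ℝ E).continuous.comp hf', fun y ↦ (hf y).hasFDerivAt⟩

/-- If a trajectory starts in `{f ≥ 0}` and its velocity `v` satisfies `⟪∇f, v⟫ + α f ≥ 0` almost
everywhere outside `{f > 0}`, then it remains in `{f ≥ 0}`. -/
theorem nonneg_of_velocity_constraint {E : Type*} [NormedAddCommGroup E] [InnerProductSpace ℝ E]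
    [FiniteDimensional ℝ E] {f : E → ℝ} {f' : E → E} (hf : ∀ y, HasGradientAt f (f' y) y)
    (hf' : Continuous f') {α : ℝ} (hα : 0 ≤ α) {x v : ℝ → E} {a b : ℝ} (hab : a ≤ b)
    (hv : IntervalIntegrable v volume a b)
    (hx : ∀ t ∈ Set.Icc a b, x t = x a + ∫ τ in a..t, v τ)
    (hvel : ∀ᵐ t ∂(volume : Measure ℝ), t ∈ Set.Ioo a b → f (x t) ≤ 0 →
      0 ≤ ⟪f' (x t), v t⟫ + α * f (x t))
    (ha : 0 ≤ f (x a)) : 0 ≤ f (x b) := by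
  refine ((contDiff_one_of_hasGradientAt hf hf').absolutelyContinuousOnInterval_comp_integral hv
    (by rwa [Set.uIcc_of_le hab])).nonneg_of_deriv_nonneg_of_nonpos hab ha ?_
  filter_upwards [hvel, hv.ae_hasDerivAt_integral] with t hvel hderiv ht hneg
  have hxd : HasDerivAt x (v t) t := by
    refine ((hderiv (Set.uIcc_of_le hab ▸ Set.Ioo_subset_Icc_self ht) a
      Set.left_mem_uIcc).const_add (x a)).congr_of_eventuallyEq ?_
    filter_upwards [Ioo_mem_nhds ht.1 ht.2] with s hs using hx s (Set.Ioo_subset_Icc_self hs)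
  have hφ : HasDerivAt (fun s ↦ f (x s)) ⟪f' (x t), v t⟫ t := by
    exact (hf (x t)).hasFDerivAt.comp_hasDerivAt t hxd
  rw [hφ.deriv]
  linarith [hvel ht hneg, mul_nonpos_of_nonneg_of_nonpos hα hneg]

/-- if `x` is absolutely continuous with `ẋ(t) ∈ V_α(x(t))` for a.e. `t ≥ 0`
and `x(0) ∈ C`, then `x(t) ∈ C` for all `t ≥ 0`: the velocity constraint together with a
feasible initial condition enforces the position constraint for all times. -/
theorem stmt4
    {E : Type*} [NormedAddCommGroup E] [InnerProductSpace ℝ E] [FiniteDimensional ℝ E]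
    {ng nh : ℕ} (hng : 0 < ng) (hnh : 0 < nh)
    (g : Fin ng → E → ℝ) (h : Fin nh → E → ℝ)
    (gg : Fin ng → E → E) (gh : Fin nh → E → E)
    (hg : ∀ i y, HasGradientAt (g i) (gg i y) y)
    (hh : ∀ j y, HasGradientAt (h j) (gh j y) y)
    (hggc : ∀ i, Continuous (gg i)) (hghc : ∀ j, Continuous (gh j))
    (α : ℝ) (hα : 0 ≤ α)
    (x xd : ℝ → E)
    (hii : ∀ t : ℝ, IntervalIntegrable xd volume 0 t)
    (hxint : ∀ t : ℝ, 0 ≤ t → x t = x 0 + ∫ τ in (0 : ℝ)..t, xd τ)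
    (hae : ∀ᵐ t ∂(volume : Measure ℝ), 0 ≤ t →
      (∀ j : Fin nh, ⟪gh j (x t), xd t⟫ + α * h j (x t) = 0) ∧
      ∀ i : Fin ng, g i (x t) ≤ 0 → 0 ≤ ⟪gg i (x t), xd t⟫ + α * g i (x t))
    (hx0 : (∀ i : Fin ng, 0 ≤ g i (x 0)) ∧ ∀ j : Fin nh, h j (x 0) = 0) :
    ∀ t : ℝ, 0 ≤ t → (∀ i : Fin ng, 0 ≤ g i (x t)) ∧ ∀ j : Fin nh, h j (x t) = 0 := by
  intro t ht
  have key {f : E → ℝ} {f' : E → E} (hf : ∀ y, HasGradientAt f (f' y) y) (hf' : Continuous f')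
      (hvel : ∀ᵐ s ∂(volume : Measure ℝ), 0 ≤ s → f (x s) ≤ 0 →
        0 ≤ ⟪f' (x s), xd s⟫ + α * f (x s)) (h0 : 0 ≤ f (x 0)) : 0 ≤ f (x t) := by
    refine nonneg_of_velocity_constraint hf hf' hα ht (hii t) (fun s hs ↦ hxint s hs.1) ?_ h0
    filter_upwards [hvel] with s hs hst using hs hst.1.le
  refine ⟨fun i ↦ key (hg i) (hggc i) ?_ (hx0.1 i), fun j ↦ le_antisymm ?_ ?_⟩
  · filter_upwards [hae] with s hs h0 using (hs h0).2 i
  · have hneg : ∀ y, HasGradientAt (fun z ↦ -h j z) (-gh j y) y := fun y ↦ by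
      rw [hasGradientAt_iff_hasFDerivAt, map_neg]
      exact (hh j y).hasFDerivAt.neg
    refine neg_nonneg.1 (key hneg (hghc j).neg ?_ (by simp [hx0.2 j]))
    filter_upwards [hae] with s hs h0 _
    rw [inner_neg_left]
    linarith [(hs h0).1 j]
  · refine key (hh j) (hghc j) ?_ (hx0.2 j).ge
    filter_upwards [hae] with s hs h0 _ using ((hs h0).1 j).ge
end

section
/- Assume MFCQ holds at every x ∈ ℝ^n and the convexity assumption holds, and let λ* ∈ ℝ^{n_h} × ℝ_{≥0}^{n_g} be a Karush–Kuhn–Tucker multiplier of the problem min_{x∈C} f(x) at its minimizer x*, i.e., ∇f(x*) = ∇ḡ(x*)λ* and λ*ᵀḡ(x*) = 0. Let α > 0 and let x : [0,∞) → ℝ^n be absolutely continuous with ẋ(t) ∈ V_α(x(t)) for almost every t. Then for all t ≥ 0, f(x(t)) − f* ≥ ⟨(h(x(0)), min{0, g(x(0))}), λ*⟩ e^{−αt}, where min{0, g(x(0))} is taken componentwise. -/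
open scoped RealInnerProductSpace
open MeasureTheory Filter

open Set in
/-- A function whose increments are dominated by those of an absolutely continuous function is
absolutely continuous. -/
theorem AbsolutelyContinuousOnInterval.of_dist_le {X Y : Type*} [PseudoMetricSpace X]
    [PseudoMetricSpace Y] {φ : ℝ → X} {P : ℝ → Y} {a b K : ℝ}
    (hP : AbsolutelyContinuousOnInterval P a b)
    (hφ : ∀ r ∈ uIcc a b, ∀ s ∈ uIcc a b, dist (φ r) (φ s) ≤ K * dist (P r) (P s)) :
    AbsolutelyContinuousOnInterval φ a b := by
  have hlim := Tendsto.const_mul K hP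
  rw [mul_zero] at hlim
  refine squeeze_zero' (Eventually.of_forall fun I => Finset.sum_nonneg fun i _ => dist_nonneg)
    ?_ hlim
  filter_upwards [mem_inf_of_right (mem_principal_self _)] with I hI
  rw [Finset.mul_sum]
  exact Finset.sum_le_sum fun i hi => hφ _ (hI.1 i hi).1 _ (hI.1 i hi).2

open Set in
/-- A locally Lipschitz function along an indefinite Bochner integral is absolutely continuous. -/
theorem LocallyLipschitz.absolutelyContinuousOnInterval_comp_integral
    {E : Type*} [NormedAddCommGroup E] [NormedSpace ℝ E]
    {F : E → ℝ} (hF : LocallyLipschitz F) {v : ℝ → E} {T : ℝ}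
    (hv : IntervalIntegrable v volume 0 T) (c : E) :
    AbsolutelyContinuousOnInterval (fun t => F (c + ∫ τ in (0 : ℝ)..t, v τ)) 0 T := by
  have hcont : ContinuousOn (fun t => c + ∫ τ in (0 : ℝ)..t, v τ) (uIcc 0 T) :=
    continuousOn_const.add
      (intervalIntegral.continuousOn_primitive_interval' hv left_mem_uIcc)
  obtain ⟨K, hK⟩ := LocallyLipschitzOn.exists_lipschitzOnWith_of_compact
    (isCompact_uIcc.image_of_continuousOn hcont) hF.locallyLipschitzOn
  refine (hv.norm.absolutelyContinuousOnInterval_intervalIntegral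
    (left_mem_uIcc)).of_dist_le (K := K) fun r hr s hs => ?_
  refine (hK.dist_le_mul _ (mem_image_of_mem _ hr) _ (mem_image_of_mem _ hs)).trans ?_
  have hvr : IntervalIntegrable v volume 0 r :=
    hv.mono_set (uIcc_subset_uIcc left_mem_uIcc hr)
  have hvs : IntervalIntegrable v volume 0 s :=
    hv.mono_set (uIcc_subset_uIcc left_mem_uIcc hs)
  gcongr
  rw [dist_add_left, dist_eq_norm, Real.dist_eq,
    intervalIntegral.integral_interval_sub_left hvr hvs,
    intervalIntegral.integral_interval_sub_left hvr.norm hvs.norm]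
  exact intervalIntegral.norm_integral_le_abs_integral_norm

theorem HasGradientAt.hasDerivAt_comp {E : Type*} [NormedAddCommGroup E] [InnerProductSpace ℝ E]
    [CompleteSpace E] {F : E → ℝ} {y : ℝ → E} {G v : E} {t : ℝ}
    (hF : HasGradientAt F G (y t)) (hy : HasDerivAt y v t) :
    HasDerivAt (fun s => F (y s)) ⟪G, v⟫ t := by
  simpa using! hF.hasFDerivAt.comp_hasDerivAt t hy

theorem ConvexOn.inner_gradient_le_sub {E : Type*} [NormedAddCommGroup E]
    [InnerProductSpace ℝ E] [CompleteSpace E] {F : E → ℝ} {G a : E}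
    (hF : ConvexOn ℝ Set.univ F) (hG : HasGradientAt F G a) (b : E) :
    ⟪G, b - a⟫ ≤ F b - F a := by
  have hline : HasDerivAt (AffineMap.lineMap a b : ℝ → E) (b - a) 0 :=
    AffineMap.hasDerivAt_lineMap
  have hd : HasDerivAt (fun s : ℝ => F (AffineMap.lineMap a b s)) ⟪G, b - a⟫ 0 :=
    HasGradientAt.hasDerivAt_comp (by simpa using hG) hline
  have hc : ConvexOn ℝ Set.univ (fun s : ℝ => F (AffineMap.lineMap a b s)) :=
    hF.comp_affineMap (AffineMap.lineMap a b)
  simpa [slope_def_field] using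
    hc.le_slope_of_hasDerivAt (Set.mem_univ 0) (Set.mem_univ 1) one_pos hd

theorem ConcaveOn.sub_le_inner_gradient {E : Type*} [NormedAddCommGroup E]
    [InnerProductSpace ℝ E] [CompleteSpace E] {F : E → ℝ} {G a : E}
    (hF : ConcaveOn ℝ Set.univ F) (hG : HasGradientAt F G a) (b : E) :
    F b - F a ≤ ⟪G, b - a⟫ := by
  have hneg : HasGradientAt (-F) (-G) a := by
    rw [hasGradientAt_iff_hasFDerivAt, map_neg]
    exact hG.hasFDerivAt.neg
  have := hF.neg.inner_gradient_le_sub hneg b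
  simp only [inner_neg_left, Pi.neg_apply] at this
  linarith

theorem HasDerivAt.exp_mul {φ : ℝ → ℝ} {d t : ℝ} (hφ : HasDerivAt φ d t) (α : ℝ) :
    HasDerivAt (fun s => Real.exp (α * s) * φ s) (Real.exp (α * t) * (d + α * φ t)) t := by
  have h := (((hasDerivAt_id t).const_mul α).exp).mul hφ
  convert! h using 1
  simp only [id, mul_one]
  ring

theorem AbsolutelyContinuousOnInterval.exp_mul {φ : ℝ → ℝ} {a b : ℝ}
    (hφ : AbsolutelyContinuousOnInterval φ a b) (α : ℝ) :
    AbsolutelyContinuousOnInterval (fun s => Real.exp (α * s) * φ s) a b :=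
  (ContDiffOn.absolutelyContinuousOnInterval (by fun_prop)).fun_mul hφ

theorem eq_mul_exp_of_ae_hasDerivAt {φ : ℝ → ℝ} {α T : ℝ} (hT : 0 ≤ T)
    (hac : AbsolutelyContinuousOnInterval φ 0 T)
    (hφ : ∀ᵐ t, t ∈ Set.Icc 0 T → ∃ d, HasDerivAt φ d t ∧ d + α * φ t = 0) :
    φ T = φ 0 * Real.exp (-(α * T)) := by
  obtain ⟨C, hC⟩ := (hac.exp_mul α).const_of_ae_hasDerivAt_zero (by
    filter_upwards [hφ] with t ht htT
    rw [Set.uIcc_of_le hT] at htT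
    obtain ⟨d, hd, hd0⟩ := ht htT
    simpa [hd0] using hd.exp_mul α)
  have h := (hC T Set.right_mem_uIcc).trans (hC 0 Set.left_mem_uIcc).symm
  simp only [mul_zero, Real.exp_zero, one_mul] at h
  rw [← h, mul_right_comm, ← Real.exp_add]
  simp

open Set in
/-- If `φ' ≥ -α φ` almost everywhere on the set where `φ ≤ 0`, then the negative part of `φ`
decays at least exponentially with rate `α`. -/
theorem min_zero_mul_exp_le_of_ae_hasDerivAt {φ : ℝ → ℝ} {α T : ℝ} (hT : 0 ≤ T)
    (hac : AbsolutelyContinuousOnInterval φ 0 T)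
    (hφ : ∀ᵐ t, t ∈ Icc 0 T → φ t ≤ 0 → ∃ d, HasDerivAt φ d t ∧ 0 ≤ d + α * φ t) :
    min 0 (φ 0) * Real.exp (-(α * T)) ≤ φ T := by
  set ψ : ℝ → ℝ := fun s => Real.exp (α * s) * φ s with hψ
  have hψac : AbsolutelyContinuousOnInterval ψ 0 T := hac.exp_mul α
  set m := min 0 (φ 0)
  suffices hm : m ≤ ψ T by
    calc m * Real.exp (-(α * T)) ≤ ψ T * Real.exp (-(α * T)) := by gcongr
      _ = φ T := by
        simp only [hψ]
        rw [mul_right_comm, ← Real.exp_add]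
        simp
  by_contra! hlt
  have hcont : ContinuousOn ψ (Icc 0 T) := by
    simpa only [uIcc_of_le hT] using hψac.continuousOn
  have hcompact : IsCompact (Icc 0 T ∩ ψ ⁻¹' Ici m) :=
    isCompact_Icc.of_isClosed_subset (hcont.preimage_isClosed_of_isClosed isClosed_Icc isClosed_Ici)
      inter_subset_left
  have hne : (Icc 0 T ∩ ψ ⁻¹' Ici m).Nonempty :=
    ⟨0, ⟨left_mem_Icc.2 hT, by simp [hψ, m]⟩⟩
  obtain ⟨s, ⟨hsT, hms⟩, hmax⟩ := hcompact.exists_isGreatest hne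
  have hint : 0 ≤ ∫ t in s..T, deriv ψ t := by
    refine intervalIntegral.integral_nonneg_of_ae_restrict hsT.2 ?_
    rw [EventuallyLE, ae_restrict_iff' measurableSet_Icc]
    have hne_s : ∀ᵐ t : ℝ, t ≠ s := by simp [ae_iff, measure_singleton]
    filter_upwards [hφ, hne_s] with t ht hts htI
    have ht0 : t ∈ Icc 0 T := ⟨hsT.1.trans htI.1, htI.2⟩
    have hst : s < t := lt_of_le_of_ne htI.1 hts.symm
    have hψt : ψ t < m := by
      by_contra! hmt
      exact hst.not_ge (hmax ⟨ht0, hmt⟩)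
    have hφt : φ t ≤ 0 := by
      by_contra! hpos
      exact (hψt.trans_le (min_le_left _ _)).not_ge (by positivity)
    obtain ⟨d, hd, hd0⟩ := ht ht0 hφt
    rw [Pi.zero_apply, (hd.exp_mul α).deriv]
    positivity
  have hmono : uIcc s T ⊆ uIcc 0 T := uIcc_subset_uIcc (by rwa [uIcc_of_le hT]) right_mem_uIcc
  rw [(hψac.mono hmono).integral_deriv_eq_sub] at hint
  have hms' : m ≤ ψ s := hms
  linarith

/-- under MFCQ everywhere and the convexity assumption, if `λ* = (λh*, λg*)` is a
KKT multiplier of `min_{x∈C} f` at the minimizer `x*`, `α > 0`, and `x` is absolutely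
continuous with `ẋ(t) ∈ V_α(x(t))` a.e., then for all `t ≥ 0`,
`f(x(t)) − f* ≥ ⟨(h(x(0)), min{0, g(x(0))}), λ*⟩ e^{−αt}`. -/
theorem stmt6
    {E : Type*} [NormedAddCommGroup E] [InnerProductSpace ℝ E] [FiniteDimensional ℝ E]
    {ng nh : ℕ} (hng : 0 < ng) (hnh : 0 < nh)
    (f : E → ℝ) (g : Fin ng → E → ℝ) (h : Fin nh → E → ℝ)
    (gf : E → E) (gg : Fin ng → E → E) (gh : Fin nh → E → E)
    (hf : ∀ y, HasGradientAt f (gf y) y)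
    (hg : ∀ i y, HasGradientAt (g i) (gg i y) y)
    (hh : ∀ j y, HasGradientAt (h j) (gh j y) y)
    (hgfc : Continuous gf) (hggc : ∀ i, Continuous (gg i)) (hghc : ∀ j, Continuous (gh j))
    -- MFCQ at every point
    (mfcq : ∀ x : E, LinearIndependent ℝ (fun j : Fin nh => gh j x) ∧
      ∃ w : E, (∀ j : Fin nh, ⟪gh j x, w⟫ = 0) ∧
        ∀ i : Fin ng, g i x ≤ 0 → 0 < ⟪gg i x, w⟫)
    -- convexity assumption
    (hhaff : ∀ j, ConvexOn ℝ Set.univ (h j) ∧ ConcaveOn ℝ Set.univ (h j))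
    (hgconc : ∀ i, ConcaveOn ℝ Set.univ (g i))
    {μ : ℝ} (hμ : 0 < μ) (hfsc : StrongConvexOn Set.univ μ f)
    (hcoer : Tendsto f (cocompact E) atTop)
    (hCne : {y : E | (∀ i, 0 ≤ g i y) ∧ ∀ j, h j y = 0}.Nonempty)
    (hCbd : Bornology.IsBounded {y : E | (∀ i, 0 ≤ g i y) ∧ ∀ j, h j y = 0})
    (xstar : E) (hxsC : (∀ i, 0 ≤ g i xstar) ∧ ∀ j, h j xstar = 0)
    (hxsmin : ∀ y : E, ((∀ i, 0 ≤ g i y) ∧ ∀ j, h j y = 0) → f xstar ≤ f y)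
    -- KKT multiplier `λ* = (lamhs, lamgs)` of the problem at `x*`
    (lamhs : Fin nh → ℝ) (lamgs : Fin ng → ℝ)
    (hlamgs : ∀ i, 0 ≤ lamgs i)
    (hstat : gf xstar = (∑ j : Fin nh, lamhs j • gh j xstar) +
      ∑ i : Fin ng, lamgs i • gg i xstar)
    (hcs : (∑ j : Fin nh, lamhs j * h j xstar) + ∑ i : Fin ng, lamgs i * g i xstar = 0)
    -- parameter
    {α : ℝ} (hα0 : 0 < α)
    -- the absolutely continuous trajectory with `ẋ(t) ∈ V_α(x(t))` a.e.
    (x xd : ℝ → E)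
    (hii : ∀ t : ℝ, IntervalIntegrable xd volume 0 t)
    (hxint : ∀ t : ℝ, 0 ≤ t → x t = x 0 + ∫ τ in (0 : ℝ)..t, xd τ)
    (hae : ∀ᵐ t ∂(volume : Measure ℝ), 0 ≤ t →
      (∀ j : Fin nh, ⟪gh j (x t), xd t⟫ + α * h j (x t) = 0) ∧
      ∀ i : Fin ng, g i (x t) ≤ 0 → 0 ≤ ⟪gg i (x t), xd t⟫ + α * g i (x t)) :
    ∀ t : ℝ, 0 ≤ t →
      ((∑ j : Fin nh, h j (x 0) * lamhs j) + ∑ i : Fin ng, min 0 (g i (x 0)) * lamgs i) *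
          Real.exp (-(α * t)) ≤ f (x t) - f xstar := by
  intro T hT
  set y : ℝ → E := fun t => x 0 + ∫ τ in (0 : ℝ)..t, xd τ with hy
  have hxy : ∀ t, 0 ≤ t → x t = y t := hxint
  have hy' : ∀ᵐ t, t ∈ Set.Icc 0 T → HasDerivAt y (xd t) t := by
    filter_upwards [(hii T).ae_hasDerivAt_integral] with t ht htT
    rw [Set.uIcc_of_le hT] at ht
    exact (ht htT 0 (Set.left_mem_Icc.2 hT)).const_add _
  have hgT : ∀ i, min 0 (g i (x 0)) * Real.exp (-(α * T)) ≤ g i (x T) := by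
    intro i
    rw [hxy 0 le_rfl, hxy T hT]
    refine min_zero_mul_exp_le_of_ae_hasDerivAt (φ := fun t => g i (y t)) hT
      ((hgconc i).locallyLipschitz.absolutelyContinuousOnInterval_comp_integral (hii T) _) ?_
    filter_upwards [hy', hae] with t hyt ht htT hneg
    refine ⟨_, (hg i (y t)).hasDerivAt_comp (hyt htT), ?_⟩
    rw [hxy t htT.1] at ht
    exact (ht htT.1).2 i hneg
  have hhT : ∀ j, h j (x T) = h j (x 0) * Real.exp (-(α * T)) := by
    intro j
    rw [hxy 0 le_rfl, hxy T hT]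
    refine eq_mul_exp_of_ae_hasDerivAt (φ := fun t => h j (y t)) hT
      ((hhaff j).1.locallyLipschitz.absolutelyContinuousOnInterval_comp_integral (hii T) _) ?_
    filter_upwards [hy', hae] with t hyt ht htT
    refine ⟨_, (hh j (y t)).hasDerivAt_comp (hyt htT), ?_⟩
    rw [hxy t htT.1] at ht
    exact (ht htT.1).1 j
  have hfconv : ConvexOn ℝ Set.univ f :=
    UniformConvexOn.convexOn hfsc fun r => by simp only [Pi.zero_apply]; positivity
  have hcs' : ∑ i : Fin ng, lamgs i * g i xstar = 0 := by
    simpa [hxsC.2] using hcs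
  calc _ = (∑ j : Fin nh, lamhs j * (h j (x 0) * Real.exp (-(α * T)))) +
          ∑ i : Fin ng, lamgs i * (min 0 (g i (x 0)) * Real.exp (-(α * T))) := by
        rw [add_mul, Finset.sum_mul, Finset.sum_mul]
        congr 1 <;> exact Finset.sum_congr rfl fun _ _ => by ring
    _ ≤ (∑ j : Fin nh, lamhs j * h j (x T)) + ∑ i : Fin ng, lamgs i * g i (x T) := by
        simp only [hhT]
        gcongr with i _
        · exact hlamgs i
        · exact hgT i
    _ = (∑ j : Fin nh, lamhs j * (h j (x T) - h j xstar)) +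
          ∑ i : Fin ng, lamgs i * (g i (x T) - g i xstar) := by
        simp [mul_sub, Finset.sum_sub_distrib, hcs', hxsC.2]
    _ ≤ (∑ j : Fin nh, lamhs j * ⟪gh j xstar, x T - xstar⟫) +
          ∑ i : Fin ng, lamgs i * ⟪gg i xstar, x T - xstar⟫ := by
        refine add_le_add (Finset.sum_le_sum fun j _ => ?_) (Finset.sum_le_sum fun i _ => ?_)
        · rw [le_antisymm ((hhaff j).2.sub_le_inner_gradient (hh j xstar) (x T))
            ((hhaff j).1.inner_gradient_le_sub (hh j xstar) (x T))]
        · exact mul_le_mul_of_nonneg_left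
            ((hgconc i).sub_le_inner_gradient (hg i xstar) (x T)) (hlamgs i)
    _ = ⟪gf xstar, x T - xstar⟫ := by
        rw [hstat, inner_add_left, sum_inner, sum_inner]
        simp [real_inner_smul_left]
    _ ≤ f (x T) - f xstar := hfconv.inner_gradient_le_sub (hf xstar) (x T)
end

section
/- Assume MFCQ holds at every x ∈ ℝ^n and the convexity assumption holds. Fix x ∈ ℝ^n, let λ*_{I_x} be a KKT multiplier of the restricted problem with constraint index set I_x (so λ*_{I_x} ∈ D_x), and let L_l ≥ μ be such that y ↦ ∇_x l(y, λ*_{I_x}) is L_l-Lipschitz. If 0 < α ≤ μ ≤ L_l, then d(x) ≥ f*_{I_x} − (1/(2α)) (L_l/α)(1 − α/L_l) |v(x)|². -/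
open scoped RealInnerProductSpace
open Filter

section GradientInequalities

variable {E : Type*} [NormedAddCommGroup E] [InnerProductSpace ℝ E] [CompleteSpace E]

lemma HasGradientAt.hasDerivAt_add_smul {φ : E → ℝ} {φ' x w : E} {t : ℝ}
    (hφ : HasGradientAt φ φ' (x + t • w)) :
    HasDerivAt (fun s : ℝ => φ (x + s • w)) ⟪φ', w⟫ t := by
  have hline : HasDerivAt (fun s : ℝ => x + s • w) w t := by
    simpa using ((hasDerivAt_id t).smul_const w).const_add x
  simpa [Function.comp_def] using hφ.hasFDerivAt.comp_hasDerivAt t hline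

/-- The descent lemma: a function with `L`-Lipschitz gradient is bounded above by its
first-order expansion plus `L / 2` times the squared displacement. -/
lemma le_add_inner_add_of_lipschitz_gradient {φ : E → ℝ} {φ' : E → E} {L : ℝ}
    (hφ : ∀ y, HasGradientAt φ (φ' y) y) (hL : ∀ y z, ‖φ' y - φ' z‖ ≤ L * ‖y - z‖) (x w : E) :
    φ (x + w) ≤ φ x + ⟪φ' x, w⟫ + L / 2 * ‖w‖ ^ 2 := by
  have hder : ∀ t : ℝ, HasDerivAt
      (fun s : ℝ => φ (x + s • w) - (s * ⟪φ' x, w⟫ + s ^ 2 * (L / 2 * ‖w‖ ^ 2)))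
      (⟪φ' (x + t • w), w⟫ - (⟪φ' x, w⟫ + 2 * t * (L / 2 * ‖w‖ ^ 2))) t := by
    intro t
    have hlin := (hasDerivAt_id t).mul_const ⟪φ' x, w⟫
    have hsq := (hasDerivAt_pow 2 t).mul_const (L / 2 * ‖w‖ ^ 2)
    simpa [Pi.sub_def, Pi.add_def] using (hφ _).hasDerivAt_add_smul.sub (hlin.add hsq)
  have hanti := antitoneOn_of_deriv_nonpos (convex_Icc (0 : ℝ) 1)
    (fun t _ => (hder t).continuousAt.continuousWithinAt)
    (fun t _ => (hder t).differentiableAt.differentiableWithinAt) (by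
      intro t ht
      rw [interior_Icc] at ht
      rw [(hder t).deriv]
      have hcs : ⟪φ' (x + t • w) - φ' x, w⟫ ≤ L * ‖x + t • w - x‖ * ‖w‖ :=
        (real_inner_le_norm _ _).trans
          (mul_le_mul_of_nonneg_right (hL _ _) (norm_nonneg _))
      rw [inner_sub_left, add_sub_cancel_left, norm_smul, Real.norm_of_nonneg ht.1.le] at hcs
      nlinarith)
  have h01 := hanti (Set.left_mem_Icc.2 zero_le_one) (Set.right_mem_Icc.2 zero_le_one) zero_le_one
  simp only [one_smul, zero_smul, add_zero] at h01
  linarith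

/-- A convex function attains its global minimum wherever its gradient vanishes. -/
lemma ConvexOn.le_of_hasGradientAt_zero {φ : E → ℝ} {z : E} (hc : ConvexOn ℝ Set.univ φ)
    (hz : HasGradientAt φ 0 z) (y : E) : φ z ≤ φ y := by
  have hline : ConvexOn ℝ Set.univ (fun s : ℝ => φ (z + s • (y - z))) := by
    simpa [Function.comp_def, AffineMap.lineMap_apply, add_comm] using
      hc.comp_affineMap (AffineMap.lineMap z y : ℝ →ᵃ[ℝ] E)
  have hder : HasDerivAt (fun s : ℝ => φ (z + s • (y - z))) ⟪(0 : E), y - z⟫ 0 :=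
    HasGradientAt.hasDerivAt_add_smul (by simpa using hz)
  have hslope := hline.le_slope_of_hasDerivAt (Set.mem_univ 0) (Set.mem_univ 1) one_pos hder
  simpa [slope_def_field] using hslope

end GradientInequalities

section Lagrangian

variable {E ι κ : Type*} [NormedAddCommGroup E] [InnerProductSpace ℝ E] [Fintype ι] [Fintype κ]
  {f : E → ℝ} {h : ι → E → ℝ} {g : κ → E → ℝ} (a : ι → ℝ) (b : κ → ℝ)

lemma hasGradientAt_lagrangian [CompleteSpace E] {y gf : E} {gh : ι → E} {gg : κ → E}
    (hf : HasGradientAt f gf y) (hh : ∀ j, HasGradientAt (h j) (gh j) y)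
    (hg : ∀ i, HasGradientAt (g i) (gg i) y) :
    HasGradientAt (fun y => f y - ((∑ j, a j * h j y) + ∑ i, b i * g i y))
      (gf - ((∑ j, a j • gh j) + ∑ i, b i • gg i)) y := by
  simp only [hasGradientAt_iff_hasFDerivAt] at *
  simp only [map_sub, map_add, map_sum, map_smul]
  exact hf.sub ((HasFDerivAt.fun_sum fun j _ => (hh j).const_mul (a j)).add
    (HasFDerivAt.fun_sum fun i _ => (hg i).const_mul (b i)))

lemma convexOn_lagrangian (hf : ConvexOn ℝ Set.univ f)
    (hh : ∀ j, ConvexOn ℝ Set.univ (h j) ∧ ConcaveOn ℝ Set.univ (h j))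
    (hg : ∀ i, ConcaveOn ℝ Set.univ (g i)) (hb : ∀ i, 0 ≤ b i) :
    ConvexOn ℝ Set.univ (fun y => f y - ((∑ j, a j * h j y) + ∑ i, b i * g i y)) := by
  refine ⟨convex_univ, fun u _ v _ s t hs ht hst => ?_⟩
  have hfc := hf.2 (Set.mem_univ u) (Set.mem_univ v) hs ht hst
  have hhc : ∑ j, a j * h j (s • u + t • v)
      = s * ∑ j, a j * h j u + t * ∑ j, a j * h j v := by
    rw [Finset.mul_sum, Finset.mul_sum, ← Finset.sum_add_distrib]
    refine Finset.sum_congr rfl fun j _ => ?_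
    have heq := le_antisymm ((hh j).1.2 (Set.mem_univ u) (Set.mem_univ v) hs ht hst)
      ((hh j).2.2 (Set.mem_univ u) (Set.mem_univ v) hs ht hst)
    rw [heq, smul_eq_mul, smul_eq_mul]
    ring
  have hgc : s * ∑ i, b i * g i u + t * ∑ i, b i * g i v
      ≤ ∑ i, b i * g i (s • u + t • v) := by
    rw [Finset.mul_sum, Finset.mul_sum, ← Finset.sum_add_distrib]
    refine Finset.sum_le_sum fun i _ => ?_
    have hle := mul_le_mul_of_nonneg_left
      ((hg i).2 (Set.mem_univ u) (Set.mem_univ v) hs ht hst) (hb i)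
    simp only [smul_eq_mul] at hle
    linarith
  simp only [smul_eq_mul] at hfc ⊢
  linarith

end Lagrangian

lemma nonpos_of_forall_mul_le_sq_mul {c K : ℝ} (hK : 0 ≤ K)
    (hc : ∀ s : ℝ, 0 < s → s ≤ 1 → s * c ≤ s ^ 2 * K) : c ≤ 0 := by
  by_contra! hpos
  have hs : 0 < c / (c + 2 * K) := by positivity
  have hle := hc _ hs (by rw [div_le_one (by positivity)]; linarith)
  rw [sq, mul_assoc, mul_le_mul_iff_right₀ hs, div_mul_eq_mul_div,
    le_div_iff₀ (by positivity)] at hle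
  nlinarith [mul_nonneg hpos.le hK, mul_pos hpos hpos]

/-- If the concave quadratic `t ↦ p - t a - |F - t G|² / (2α)` is maximal over `[0, 1]` at `t = 1`,
then its maximum bounds the primal objective `p + (⟪F, v⟫ + |v|² / 2) / α` at `v = G - F`. -/
lemma primal_le_of_scaling_max {E : Type*} [NormedAddCommGroup E] [InnerProductSpace ℝ E]
    {F G v : E} {α p a : ℝ} (hα : 0 < α) (hv : v = -(F - G))
    (hmax : ∀ t : ℝ, 0 ≤ t → t ≤ 1 →
      p - t * a - 1 / (2 * α) * ‖F - t • G‖ ^ 2 ≤ p - a - 1 / (2 * α) * ‖F - G‖ ^ 2) :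
    p + 1 / α * ⟪F, v⟫ + 1 / (2 * α) * ‖v‖ ^ 2 ≤ p - a - 1 / (2 * α) * ‖F - G‖ ^ 2 := by
  have hslack : a + 1 / α * ⟪G, v⟫ ≤ 0 := by
    refine nonpos_of_forall_mul_le_sq_mul (K := 1 / (2 * α) * ‖G‖ ^ 2) (by positivity)
      fun s hs hs1 => ?_
    have hle := hmax (1 - s) (by linarith) (by linarith)
    have hexp : ‖F - (1 - s) • G‖ ^ 2
        = ‖F - G‖ ^ 2 - 2 * s * ⟪G, v⟫ + s ^ 2 * ‖G‖ ^ 2 := by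
      rw [show F - (1 - s) • G = (F - G) + s • G by module, norm_add_sq_real, inner_smul_right,
        norm_smul, mul_pow, Real.norm_eq_abs, sq_abs, hv, inner_neg_right,
        real_inner_comm G]
      ring
    rw [hexp] at hle
    have hhalf : 1 / (2 * α) * (2 * s * ⟪G, v⟫) = s * (1 / α * ⟪G, v⟫) := by
      field_simp
    linarith
  have hF : ⟪F, v⟫ = ⟪G, v⟫ - ‖v‖ ^ 2 := by
    rw [show F = G - v by rw [hv]; abel, inner_sub_left, real_inner_self_eq_norm_sq]
  have hnorm : ‖F - G‖ = ‖v‖ := by rw [hv, norm_neg]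
  have hcancel : 1 / α * ‖v‖ ^ 2 = 2 * (1 / (2 * α) * ‖v‖ ^ 2) := by field_simp
  rw [hF, hnorm]
  linarith

/-- under MFCQ everywhere and the convexity assumption, fix `x`, let
`λ*_{I_x} = (lamhI, lamgI) ∈ D_x` be a KKT multiplier of the restricted problem with index
set `I_x` (with minimizer `zI`), and let `L_l ≥ μ` be a Lipschitz constant of
`y ↦ ∇_x l(y, λ*_{I_x})`.  If `0 < α ≤ μ ≤ L_l` then
`d(x) ≥ f*_{I_x} − (1/(2α))(L_l/α)(1 − α/L_l)‖v(x)‖²`. -/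
theorem stmt12
    {E : Type*} [NormedAddCommGroup E] [InnerProductSpace ℝ E] [FiniteDimensional ℝ E]
    {ng nh : ℕ} (hng : 0 < ng) (hnh : 0 < nh)
    (f : E → ℝ) (g : Fin ng → E → ℝ) (h : Fin nh → E → ℝ)
    (gf : E → E) (gg : Fin ng → E → E) (gh : Fin nh → E → E)
    (hf : ∀ y, HasGradientAt f (gf y) y)
    (hg : ∀ i y, HasGradientAt (g i) (gg i y) y)
    (hh : ∀ j y, HasGradientAt (h j) (gh j y) y)
    (hgfc : Continuous gf) (hggc : ∀ i, Continuous (gg i)) (hghc : ∀ j, Continuous (gh j))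
    -- Lipschitz gradients
    (Lf Lg Lh : ℝ)
    (hgfL : ∀ y z, ‖gf y - gf z‖ ≤ Lf * ‖y - z‖)
    (hggL : ∀ i y z, ‖gg i y - gg i z‖ ≤ Lg * ‖y - z‖)
    (hghL : ∀ j y z, ‖gh j y - gh j z‖ ≤ Lh * ‖y - z‖)
    -- MFCQ at every point
    (mfcq : ∀ x : E, LinearIndependent ℝ (fun j : Fin nh => gh j x) ∧
      ∃ w : E, (∀ j : Fin nh, ⟪gh j x, w⟫ = 0) ∧
        ∀ i : Fin ng, g i x ≤ 0 → 0 < ⟪gg i x, w⟫)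
    -- convexity assumption
    (hhaff : ∀ j, ConvexOn ℝ Set.univ (h j) ∧ ConcaveOn ℝ Set.univ (h j))
    (hgconc : ∀ i, ConcaveOn ℝ Set.univ (g i))
    {μ : ℝ} (hμ : 0 < μ) (hfsc : StrongConvexOn Set.univ μ f)
    (hcoer : Tendsto f (cocompact E) atTop)
    (hCne : {y : E | (∀ i, 0 ≤ g i y) ∧ ∀ j, h j y = 0}.Nonempty)
    (hCbd : Bornology.IsBounded {y : E | (∀ i, 0 ≤ g i y) ∧ ∀ j, h j y = 0})
    (xstar : E) (hxsC : (∀ i, 0 ≤ g i xstar) ∧ ∀ j, h j xstar = 0)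
    (hxsmin : ∀ y : E, ((∀ i, 0 ≤ g i y) ∧ ∀ j, h j y = 0) → f xstar ≤ f y)
    -- parameter range
    {α : ℝ} (hα0 : 0 < α) (hαμ : α ≤ μ)
    -- the maximizer `λ(·) = (lamh ·, lamg ·) ∈ D_x` of the dual, and the dual function `d`
    (lamh : E → Fin nh → ℝ) (lamg : E → Fin ng → ℝ)
    (hlam_nn : ∀ y i, 0 ≤ lamg y i)
    (hlam_supp : ∀ y i, 0 < g i y → lamg y i = 0)
    (dval : E → ℝ)
    (hd_eq : ∀ y : E, dval y =
      (f y - ((∑ j : Fin nh, lamh y j * h j y) + ∑ i : Fin ng, lamg y i * g i y)) -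
        1/(2*α) * ‖gf y - ((∑ j : Fin nh, lamh y j • gh j y) +
          ∑ i : Fin ng, lamg y i • gg i y)‖^2)
    (hd_max : ∀ (y : E) (lh : Fin nh → ℝ) (lg : Fin ng → ℝ),
      (∀ i, 0 ≤ lg i) → (∀ i, 0 < g i y → lg i = 0) →
      (f y - ((∑ j : Fin nh, lh j * h j y) + ∑ i : Fin ng, lg i * g i y)) -
        1/(2*α) * ‖gf y - ((∑ j : Fin nh, lh j • gh j y) +
          ∑ i : Fin ng, lg i • gg i y)‖^2 ≤ dval y)
    -- the velocity field `v(·)` and its relation to `λ(·)`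
    (vfun : E → E)
    (hv_mem : ∀ y : E, (∀ j : Fin nh, ⟪gh j y, vfun y⟫ + α * h j y = 0) ∧
      ∀ i : Fin ng, g i y ≤ 0 → 0 ≤ ⟪gg i y, vfun y⟫ + α * g i y)
    (hv_min : ∀ y u : E, (∀ j : Fin nh, ⟪gh j y, u⟫ + α * h j y = 0) →
      (∀ i : Fin ng, g i y ≤ 0 → 0 ≤ ⟪gg i y, u⟫ + α * g i y) →
      1/2 * ‖vfun y + gf y‖^2 ≤ 1/2 * ‖u + gf y‖^2)
    (hv_lam : ∀ y : E, vfun y =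
      -(gf y - ((∑ j : Fin nh, lamh y j • gh j y) + ∑ i : Fin ng, lamg y i • gg i y)))
    -- the fixed point `x`, a minimizer `zI` of the restricted problem with index set `I_x`,
    -- and a KKT multiplier `λ*_{I_x} = (lamhI, lamgI)` of that restricted problem
    (x zI : E)
    (hzI_feas : (∀ j : Fin nh, h j zI = 0) ∧ ∀ i : Fin ng, g i x ≤ 0 → 0 ≤ g i zI)
    (hzI_min : ∀ z : E, ((∀ j : Fin nh, h j z = 0) ∧ ∀ i : Fin ng, g i x ≤ 0 → 0 ≤ g i z) →
      f zI ≤ f z)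
    (lamhI : Fin nh → ℝ) (lamgI : Fin ng → ℝ)
    (hlamgI_nn : ∀ i, 0 ≤ lamgI i)
    (hlamgI_supp : ∀ i : Fin ng, 0 < g i x → lamgI i = 0)
    (hstatI : gf zI = (∑ j : Fin nh, lamhI j • gh j zI) + ∑ i : Fin ng, lamgI i • gg i zI)
    (hcsI : ∀ i : Fin ng, lamgI i * g i zI = 0)
    -- `L_l` is a Lipschitz constant of `y ↦ ∇_x l(y, λ*_{I_x})`, with `0 < α ≤ μ ≤ L_l`
    {Ll : ℝ} (hμLl : μ ≤ Ll)
    (hLlI : ∀ z z' : E,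
      ‖(gf z - ((∑ j : Fin nh, lamhI j • gh j z) + ∑ i : Fin ng, lamgI i • gg i z)) -
        (gf z' - ((∑ j : Fin nh, lamhI j • gh j z') +
          ∑ i : Fin ng, lamgI i • gg i z'))‖ ≤ Ll * ‖z - z'‖) :
    f zI - 1/(2*α) * (Ll/α) * (1 - α/Ll) * ‖vfun x‖^2 ≤ dval x := by
  have hL0 : 0 < Ll := hμ.trans_le hμLl
  have hprimal : f x + 1 / α * ⟪gf x, vfun x⟫ + 1 / (2 * α) * ‖vfun x‖ ^ 2 ≤ dval x := by
    rw [hd_eq x]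
    refine primal_le_of_scaling_max hα0 (hv_lam x) fun t ht _ => ?_
    have hle := hd_max x (fun j => t * lamh x j) (fun i => t * lamg x i)
      (fun i => mul_nonneg ht (hlam_nn x i)) (fun i hi => by simp [hlam_supp x i hi])
    rw [hd_eq x] at hle
    simpa only [mul_assoc, mul_smul, ← Finset.mul_sum, ← Finset.smul_sum, ← mul_add, ← smul_add]
      using hle
  have hfeas : 0 ≤ α * ((∑ j, lamhI j * h j x) + ∑ i, lamgI i * g i x)
      + ⟪(∑ j, lamhI j • gh j x) + ∑ i, lamgI i • gg i x, vfun x⟫ := by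
    have hh0 : α * (∑ j, lamhI j * h j x) + ⟪∑ j, lamhI j • gh j x, vfun x⟫ = 0 := by
      rw [sum_inner, Finset.mul_sum, ← Finset.sum_add_distrib]
      refine Finset.sum_eq_zero fun j _ => ?_
      rw [real_inner_smul_left]
      linear_combination lamhI j * (hv_mem x).1 j
    have hg0 : 0 ≤ α * (∑ i, lamgI i * g i x) + ⟪∑ i, lamgI i • gg i x, vfun x⟫ := by
      rw [sum_inner, Finset.mul_sum, ← Finset.sum_add_distrib]
      refine Finset.sum_nonneg fun i _ => ?_
      rw [real_inner_smul_left]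
      rcases le_or_gt (g i x) 0 with hi | hi
      · linarith [mul_nonneg (hlamgI_nn i) ((hv_mem x).2 i hi)]
      · simp [hlamgI_supp i hi]
    rw [inner_add_left]
    linarith
  have hgrad := fun y => hasGradientAt_lagrangian lamhI lamgI (hf y) (fun j => hh j y)
    (fun i => hg i y)
  have hconv := convexOn_lagrangian lamhI lamgI (hfsc.strictConvexOn hμ).convexOn hhaff hgconc
    hlamgI_nn
  have hmin := hconv.le_of_hasGradientAt_zero (z := zI)
    (by simpa [← hstatI] using hgrad zI) (x + (1 / α) • vfun x)
  have hdesc := le_add_inner_add_of_lipschitz_gradient hgrad hLlI x ((1 / α) • vfun x)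
  have hval := hmin.trans hdesc
  simp only [hzI_feas.1, hcsI, mul_zero, Finset.sum_const_zero, add_zero, sub_zero] at hval
  rw [inner_smul_right, inner_sub_left, norm_smul, mul_pow, Real.norm_eq_abs, sq_abs] at hval
  have hscaled := mul_nonneg (one_div_pos.2 hα0).le hfeas
  rw [mul_add, ← mul_assoc, one_div_mul_cancel hα0.ne', one_mul] at hscaled
  have hcoef : 1 / (2 * α) * (Ll / α) * (1 - α / Ll) * ‖vfun x‖ ^ 2
      = Ll / 2 * ((1 / α) ^ 2 * ‖vfun x‖ ^ 2) - 1 / (2 * α) * ‖vfun x‖ ^ 2 := by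
    field_simp
  rw [hcoef]
  linarith
end
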